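/- Let X be a separable geodesic δ-hyperbolic metric space with basepoint x0, let h ∈ X̄^h be an infinite horofunction (inf h = −∞), and let (y_n) be a sequence in X with h(y_n) → −∞. Then (y_n) is a Gromov sequence, hence converges to a point of the Gromov boundary ∂X; moreover any two such minimizing sequences for the same horofunction h converge to the same point of ∂X. -/

import Mathlib

open Filter Metric Set Topology

noncomputable section

/-- The Gromov product `(x·y)_p = ½(d(p,x) + d(p,y) − d(x,y))`. -/
def gromovProd {X : Type*} [MetricSpace X] (p x y : X) : ℝ :=
  (dist p x + dist p y - dist x y) / 2

/-- `f` is a unit-speed geodesic segment from `x` to `y`, parametrized on `[0, d(x,y)]`. -/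
def IsGeodesicSegment {X : Type*} [MetricSpace X] (f : ℝ → X) (x y : X) : Prop :=
  f 0 = x ∧ f (dist x y) = y ∧
    ∀ s ∈ Set.Icc (0 : ℝ) (dist x y), ∀ t ∈ Set.Icc (0 : ℝ) (dist x y),
      dist (f s) (f t) = |s - t|

/-- The image of a geodesic segment from `x` to `y`. -/
def geodImage {X : Type*} [MetricSpace X] (f : ℝ → X) (x y : X) : Set X :=
  f '' Set.Icc 0 (dist x y)

/-- A metric space is geodesic if any two points are joined by a geodesic segment. -/
def GeodesicSpace (X : Type*) [MetricSpace X] : Prop :=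
  ∀ x y : X, ∃ f : ℝ → X, IsGeodesicSegment f x y

/-- `X` is `δ`-hyperbolic in the sense of slim triangles: every side of every geodesic
triangle is contained in the `δ`-neighbourhood of the union of the other two sides. -/
def SlimTriangles (δ : ℝ) (X : Type*) [MetricSpace X] : Prop :=
  ∀ (x y z : X) (f g h : ℝ → X), IsGeodesicSegment f x y → IsGeodesicSegment g y z →
    IsGeodesicSegment h x z →
      ∀ p ∈ geodImage f x y, Metric.infDist p (geodImage g y z ∪ geodImage h x z) ≤ δ

/-- The shadow `S_{x0}(x, R) = { y : (x·y)_{x0} ≥ d(x0,x) − R }`. -/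
def shadow {X : Type*} [MetricSpace X] (x0 x : X) (R : ℝ) : Set X :=
  {y | dist x0 x - R ≤ gromovProd x0 x y}

/-- A `(Q,c)`-quasigeodesic, parametrized on the set `s ⊆ ℝ`. -/
def IsQuasigeodesicOn {X : Type*} [MetricSpace X] (Q c : ℝ) (f : ℝ → X) (s : Set ℝ) : Prop :=
  ∀ u ∈ s, ∀ v ∈ s,
    (1 / Q) * |u - v| - c ≤ dist (f u) (f v) ∧ dist (f u) (f v) ≤ Q * |u - v| + c

end

/-- The horofunction `ρ_y(z) = d(z,y) − d(x0,y)` associated to the point `y`, with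
basepoint `x0`. -/
def horo {X : Type*} [MetricSpace X] (x0 y : X) : X → ℝ :=
  fun z => dist z y - dist x0 y

/-- The horofunction compactification of `X` (with basepoint `x0`): the closure of the
set of horofunctions `ρ_y`, `y ∈ X`, inside `X → ℝ` with the topology of pointwise
convergence. -/
def horoCpt {X : Type*} [MetricSpace X] (x0 : X) : Set (X → ℝ) :=
  closure (Set.range (horo x0))

/-- `u` is a Gromov sequence: `(u_m · u_n)_{x0} → ∞` as `min(m,n) → ∞`. -/
def IsGromovSeq {X : Type*} [MetricSpace X] (x0 : X) (u : ℕ → X) : Prop :=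
  Filter.Tendsto (fun p : ℕ × ℕ => gromovProd x0 (u p.1) (u p.2))
    (Filter.atTop ×ˢ Filter.atTop) Filter.atTop

/-- The type of Gromov sequences in `X` (with basepoint `x0`). -/
def GromovSeq (X : Type*) [MetricSpace X] (x0 : X) : Type _ :=
  {u : ℕ → X // IsGromovSeq x0 u}

/-- Two Gromov sequences are equivalent when `(u_n · v_n)_{x0} → ∞`. -/
def gromovRel {X : Type*} [MetricSpace X] (x0 : X) (u v : GromovSeq X x0) : Prop :=
  Filter.Tendsto (fun n => gromovProd x0 (u.1 n) (v.1 n)) Filter.atTop Filter.atTop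

/-- The Gromov boundary `∂X`: equivalence classes of Gromov sequences. -/
def GromovBoundary (X : Type*) [MetricSpace X] (x0 : X) : Type _ :=
  Quot (gromovRel x0)

/-- A sequence of points of `X` converges (in `X ∪ ∂X`) to the boundary point `ξ ∈ ∂X`:
it is a Gromov sequence whose class is `ξ`. -/
def SeqConvergesTo {X : Type*} [MetricSpace X] (x0 : X) (u : ℕ → X)
    (ξ : GromovBoundary X x0) : Prop :=
  ∃ hu : IsGromovSeq x0 u, Quot.mk (gromovRel x0) ⟨u, hu⟩ = ξ

theorem IsGeodesicSegment.dist_add_dist {X : Type*} [MetricSpace X] {f : ℝ → X} {x y q : X}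
    (hf : IsGeodesicSegment f x y) (hq : q ∈ geodImage f x y) :
    dist x q + dist q y = dist x y := by
  obtain ⟨t, ht, rfl⟩ := hq
  obtain ⟨h0, h1, hd⟩ := hf
  have e1 := hd 0 ⟨le_rfl, dist_nonneg⟩ t ht
  have e2 := hd t ht (dist x y) ⟨dist_nonneg, le_rfl⟩
  rw [h0, zero_sub, abs_neg, abs_of_nonneg ht.1] at e1
  rw [h1, abs_of_nonpos (by linarith [ht.2])] at e2
  linarith

theorem IsGeodesicSegment.gromovProd_le_dist {X : Type*} [MetricSpace X] {f : ℝ → X} {x y q : X}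
    (hf : IsGeodesicSegment f x y) (hq : q ∈ geodImage f x y) (p : X) :
    gromovProd p x y ≤ dist p q := by
  have e := hf.dist_add_dist hq
  have h1 := dist_triangle p q x
  have h2 := dist_triangle p q y
  rw [dist_comm q x] at h1
  unfold gromovProd
  linarith

theorem SlimTriangles.exists_dist_lt {X : Type*} [MetricSpace X] {δ : ℝ}
    (hslim : SlimTriangles δ X) {x y z p : X} {f g k : ℝ → X} (hf : IsGeodesicSegment f x y)
    (hg : IsGeodesicSegment g y z) (hk : IsGeodesicSegment k x z) (hp : p ∈ geodImage f x y) :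
    ∃ q ∈ geodImage g y z ∪ geodImage k x z, dist p q < δ + 1 := by
  have hne : (geodImage g y z ∪ geodImage k x z).Nonempty :=
    ⟨g 0, Or.inl ⟨0, ⟨le_rfl, dist_nonneg⟩, rfl⟩⟩
  exact (Metric.infDist_lt_iff hne).1
    (lt_of_le_of_lt (hslim x y z f g k hf hg hk p hp) (lt_add_one δ))

/-- A geodesic from `a` to `b` passes within `(a·b)_p + 2(δ + 1)` of `p`. -/
theorem SlimTriangles.exists_dist_le_gromovProd_add {X : Type*} [MetricSpace X] {δ : ℝ}
    (hslim : SlimTriangles δ X) (hgeo : GeodesicSpace X) {a b : X} {f : ℝ → X}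
    (hf : IsGeodesicSegment f a b) (p : X) :
    ∃ m ∈ geodImage f a b, dist p m ≤ gromovProd p a b + 2 * (δ + 1) := by
  obtain ⟨g, hg⟩ := hgeo b p
  obtain ⟨k, hk⟩ := hgeo a p
  have ht : gromovProd a p b ∈ Set.Icc 0 (dist a b) := by
    have h1 := dist_triangle p a b
    have h2 := dist_triangle a b p
    rw [dist_comm p a] at h1
    rw [dist_comm b p] at h2
    unfold gromovProd
    constructor <;> linarith
  have hm : f (gromovProd a p b) ∈ geodImage f a b := ⟨_, ht, rfl⟩
  have ham : dist a (f (gromovProd a p b)) = gromovProd a p b := by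
    have e := hf.2.2 0 ⟨le_rfl, dist_nonneg⟩ _ ht
    rwa [hf.1, zero_sub, abs_neg, abs_of_nonneg ht.1] at e
  refine ⟨_, hm, ?_⟩
  have hsum := hf.dist_add_dist hm
  generalize f (gromovProd a p b) = m at hm ham hsum
  obtain ⟨q, hq, hmq⟩ := hslim.exists_dist_lt hf hg hk hm
  have hpm := dist_triangle_left p m q
  unfold gromovProd at *
  rw [dist_comm q p, dist_comm q m] at hpm
  rw [dist_comm p a, dist_comm p b]
  rw [dist_comm p b] at ham
  rcases hq with hq | hq
  · have e := hg.dist_add_dist hq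
    have h1 := dist_triangle b q m
    rw [dist_comm b m, dist_comm q m] at h1
    rw [dist_comm q p] at e
    linarith
  · have e := hk.dist_add_dist hq
    have h1 := dist_triangle a q m
    rw [dist_comm q m] at h1
    rw [dist_comm q p] at e
    linarith

theorem SlimTriangles.min_gromovProd_sub_le {X : Type*} [MetricSpace X] {δ : ℝ}
    (hslim : SlimTriangles δ X) (hgeo : GeodesicSpace X) (p a b w : X) :
    min (gromovProd p a w) (gromovProd p b w) - 3 * (δ + 1) ≤ gromovProd p a b := by
  obtain ⟨f, hf⟩ := hgeo a b
  obtain ⟨g, hg⟩ := hgeo b w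
  obtain ⟨k, hk⟩ := hgeo a w
  obtain ⟨m, hm, hpm⟩ := hslim.exists_dist_le_gromovProd_add hgeo hf p
  obtain ⟨q, hq, hmq⟩ := hslim.exists_dist_lt hf hg hk hm
  have hpq := dist_triangle p m q
  rcases hq with hq | hq
  · linarith [hg.gromovProd_le_dist hq p, min_le_right (gromovProd p a w) (gromovProd p b w)]
  · linarith [hk.gromovProd_le_dist hq p, min_le_left (gromovProd p a w) (gromovProd p b w)]

theorem exists_horo_lt_of_mem_horoCpt {X : Type*} [MetricSpace X] {x0 : X} {h : X → ℝ}
    (hh : h ∈ horoCpt x0) (a b : X) {ε : ℝ} (hε : 0 < ε) :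
    ∃ w, horo x0 w a < h a + ε ∧ horo x0 w b < h b + ε := by
  have hU : {g : X → ℝ | g a < h a + ε ∧ g b < h b + ε} ∈ 𝓝 h :=
    ((isOpen_lt (continuous_apply a) continuous_const).inter
      (isOpen_lt (continuous_apply b) continuous_const)).mem_nhds
        ⟨lt_add_of_pos_right _ hε, lt_add_of_pos_right _ hε⟩
  obtain ⟨_, hg, w, rfl⟩ := mem_closure_iff_nhds.1 hh _ hU
  exact ⟨w, hg⟩

theorem SlimTriangles.neg_max_horofunction_le_gromovProd {X : Type*} [MetricSpace X] {δ : ℝ}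
    (hslim : SlimTriangles δ X) (hgeo : GeodesicSpace X) {x0 : X} {h : X → ℝ}
    (hh : h ∈ horoCpt x0) (a b : X) :
    -max (h a) (h b) / 2 - (3 * (δ + 1) + 1) ≤ gromovProd x0 a b := by
  obtain ⟨w, ha, hb⟩ := exists_horo_lt_of_mem_horoCpt hh a b one_pos
  have key := hslim.min_gromovProd_sub_le hgeo x0 a b w
  have hmin : -max (h a) (h b) / 2 - 1 ≤ min (gromovProd x0 a w) (gromovProd x0 b w) := by
    unfold horo at ha hb
    unfold gromovProd
    refine le_min ?_ ?_
    · linarith [le_max_left (h a) (h b), dist_nonneg (x := x0) (y := a)]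
    · linarith [le_max_right (h a) (h b), dist_nonneg (x := x0) (y := b)]
  linarith

theorem SlimTriangles.tendsto_gromovProd {X : Type*} [MetricSpace X] {δ : ℝ}
    (hslim : SlimTriangles δ X) (hgeo : GeodesicSpace X) {x0 : X} {h : X → ℝ}
    (hh : h ∈ horoCpt x0) {ι : Type*} {l : Filter ι} {u v : ι → X}
    (hu : Tendsto (fun i => h (u i)) l atBot) (hv : Tendsto (fun i => h (v i)) l atBot) :
    Tendsto (fun i => gromovProd x0 (u i) (v i)) l atTop := by
  refine tendsto_atTop.2 fun B => ?_
  filter_upwards [tendsto_atBot.1 hu (-2 * (B + (3 * (δ + 1) + 1))),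
    tendsto_atBot.1 hv (-2 * (B + (3 * (δ + 1) + 1)))] with i hi hj
  have := hslim.neg_max_horofunction_le_gromovProd hgeo hh (u i) (v i)
  linarith [max_le hi hj]

/-- minimizing sequences converge to the boundary. Let `X` be a
separable geodesic `δ`-hyperbolic space with basepoint `x0`, let `h` be an infinite
horofunction (`inf h = −∞`), and let `(y_n)` be a minimizing sequence, `h(y_n) → −∞`.
Then `(y_n)` is a Gromov sequence, hence converges to a point `ξ` of the Gromov boundary,
and every minimizing sequence for `h` converges to the same point `ξ`. -/
theorem minimizing_sequence_converges
    {X : Type*} [MetricSpace X] [TopologicalSpace.SeparableSpace X] {δ : ℝ} (hδ : 0 ≤ δ)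
    (hgeo : GeodesicSpace X) (hslim : SlimTriangles δ X) (x0 : X)
    (h : X → ℝ) (hh : h ∈ horoCpt x0) (hinf : ¬ BddBelow (Set.range h))
    (y : ℕ → X) (hy : Filter.Tendsto (fun n => h (y n)) Filter.atTop Filter.atBot) :
    IsGromovSeq x0 y ∧
      ∃ ξ : GromovBoundary X x0, SeqConvergesTo x0 y ξ ∧
        ∀ z : ℕ → X, Filter.Tendsto (fun n => h (z n)) Filter.atTop Filter.atBot →
          SeqConvergesTo x0 z ξ := by
  have hseq : ∀ u : ℕ → X, Tendsto (fun n => h (u n)) atTop atBot → IsGromovSeq x0 u :=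
    fun u hu => hslim.tendsto_gromovProd hgeo hh (hu.comp tendsto_fst) (hu.comp tendsto_snd)
  refine ⟨hseq y hy, Quot.mk _ ⟨y, hseq y hy⟩, ⟨hseq y hy, rfl⟩, fun z hz => ?_⟩
  exact ⟨hseq z hz, Quot.sound (hslim.tendsto_gromovProd hgeo hh hz hy)⟩
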